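/- arXiv:2110.08054 — 2 statements merged into one kernel-verified Lean document; each statement's English description precedes it below -/
import Mathlib

section
/- Consider a leader-follower formation with positions p_i(t), velocities v_i(t) = ṗ_i(t), and bearings g_ij(t), all assumed well-defined and bounded for all t ≥ 0, and assume the formation is bearing persistently exciting. Let K be a positive definite 3×3 matrix and consider the observer with states p̂_i(t) for i = 2,…,n defined by p̂̇_i = v_i − K Σ_{j∈N_i} π_{g_ij(t)} (p̂_i − p̂_j), with p̂_1(t) ≡ p_1(t) and arbitrary initial conditions p̂_i(0). Then each estimation error p̃_i := p̂_i − p_i converges to zero uniformly globally exponentially: there exist k, λ > 0, independent of the initial conditions, such that ‖p̃_i(t)‖ ≤ k (Σ_{j=2}^{n} ‖p̃_j(0)‖) e^{−λ t} for all t ≥ 0 and all i = 2,…,n. -/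
open Matrix MeasureTheory Real

noncomputable section

/-- Euclidean norm of a finite-dimensional real vector. -/
def euclNorm {ι : Type*} [Fintype ι] (x : ι → ℝ) : ℝ := Real.sqrt (∑ i, x i * x i)

/-- Projector onto the plane orthogonal to the unit vector `y`: `π_y = I₃ - y yᵀ`. -/
def proj (y : Fin 3 → ℝ) : Matrix (Fin 3) (Fin 3) ℝ := 1 - Matrix.vecMulVec y y

/-- A time-varying positive semidefinite matrix `Σ(t)` is persistently exciting (PE):
there exist `T > 0` and `μ > 0` such that `(1/T) ∫_t^{t+T} Σ(τ) dτ ≥ μ I` for all `t ≥ 0`. -/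
def IsPE {ι : Type*} [Fintype ι] [DecidableEq ι] (M : ℝ → Matrix ι ι ℝ) : Prop :=
  ∃ T μ : ℝ, 0 < T ∧ 0 < μ ∧
    ∀ t : ℝ, 0 ≤ t →
      ((T⁻¹ • Matrix.of fun i j => ∫ τ in t..(t + T), M τ i j) -
        μ • (1 : Matrix ι ι ℝ)).PosSemidef

/-- Bearing of agent `j` relative to agent `i` computed from positions `p`. -/
def bearing {n : ℕ} (p : Fin n → ℝ → (Fin 3 → ℝ)) (i j : Fin n) (t : ℝ) : Fin 3 → ℝ :=
  (euclNorm (p j t - p i t))⁻¹ • (p j t - p i t)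

/-- Leader-follower structure: agent `0` is the leader with no neighbors, agent `1` is the
first follower whose only neighbor is the leader, and every agent `i ≥ 2` has a nonempty
set of neighbors of smaller index. -/
def LeaderFollower {n : ℕ} (N : Fin n → Finset (Fin n)) : Prop :=
  (∀ i : Fin n, (i : ℕ) = 0 → N i = ∅) ∧
  (∀ i : Fin n, (i : ℕ) = 1 → N i = {⟨0, lt_of_le_of_lt (Nat.zero_le _) i.isLt⟩}) ∧
  (∀ i : Fin n, 2 ≤ (i : ℕ) → (N i).Nonempty ∧ ∀ j ∈ N i, (j : ℕ) < (i : ℕ))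

set_option maxHeartbeats 2000000 in
open scoped InnerProductSpace in
theorem core_aux {E : Type*} [NormedAddCommGroup E] [InnerProductSpace ℝ E] [CompleteSpace E]
    (S : ℝ → E →L[ℝ] E) (hS : Continuous S) (L : ℝ) (hL0 : 0 < L)
    (hL : ∀ t x, ‖S t x‖ ^ 2 ≤ L * ⟪S t x, x⟫_ℝ)
    (T μ : ℝ) (hT : 0 < T) (hμ : 0 < μ)
    (hPE : ∀ t, 0 ≤ t → ∀ x, μ * ‖x‖ ^ 2 ≤ ⟪(∫ τ in t..(t + T), S τ) x, x⟫_ℝ)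
    (K P : E →L[ℝ] E) (hsym : ∀ x y, ⟪P x, y⟫_ℝ = ⟪x, P y⟫_ℝ) (hPK : ∀ x, P (K x) = x)
    (α : ℝ) (hα : 0 < α) (hP : ∀ x, α * ‖x‖ ^ 2 ≤ ⟪P x, x⟫_ℝ) (a : ℝ) (ha : 0 < a) :
    ∃ C b : ℝ, 0 < C ∧ 0 < b ∧ ∀ (x u : ℝ → E) (A : ℝ), 0 ≤ A →
      (∀ t, 0 ≤ t → HasDerivAt x (-(K (S t (x t))) + u t) t) →
      (∀ t, 0 ≤ t → ‖u t‖ ≤ A * Real.exp (-a * t)) →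
      ∀ t, 0 ≤ t → ‖x t‖ ≤ C * (‖x 0‖ + A) * Real.exp (-b * t) := by
  have hq : ∀ t x, 0 ≤ ⟪S t x, x⟫_ℝ := by
    intro t x
    have := hL t x
    by_contra h
    push Not at h
    nlinarith [sq_nonneg ‖S t x‖, mul_pos_of_neg_of_neg h (neg_lt_zero.mpr hL0)]
  have hSn : ∀ t, ‖S t‖ ≤ L := by
    intro t
    refine ContinuousLinearMap.opNorm_le_bound _ hL0.le fun x => ?_
    by_contra h
    push Not at h
    have h1 := hL t x
    have h2 := real_inner_le_norm (S t x) x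
    have h3 : 0 < ‖S t x‖ := lt_of_le_of_lt (by positivity) h
    have h4 := mul_le_mul_of_nonneg_left h2 hL0.le
    nlinarith [mul_lt_mul_of_pos_right h h3]
  set F : ℝ → E →L[ℝ] E := fun t => ∫ τ in (0:ℝ)..t, S τ with hF
  have hFd : ∀ t, HasDerivAt F (S t) t := fun t => hS.integral_hasStrictDerivAt 0 t |>.hasDerivAt
  have hFc : Continuous F := continuous_iff_continuousAt.2 fun t => (hFd t).continuousAt
  set G : ℝ → E →L[ℝ] E := fun t => ∫ τ in (0:ℝ)..t, F τ with hG
  have hGd : ∀ t, HasDerivAt G (F t) t := fun t => hFc.integral_hasStrictDerivAt 0 t |>.hasDerivAt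
  have hFsub : ∀ s t, F t - F s = ∫ τ in s..t, S τ := fun s t =>
    intervalIntegral.integral_interval_sub_left (hS.intervalIntegrable _ _)
      (hS.intervalIntegrable _ _)
  set Φ : ℝ → E →L[ℝ] E := fun t => G (t + T) - G t - T • F t with hΦ
  have hΦd : ∀ t, HasDerivAt Φ (F (t + T) - F t - T • S t) t := fun t =>
    (((hGd (t + T)).comp_add_const t T).sub (hGd t)).sub ((hFd t).const_smul T)
  set B : ℝ := L * T * T with hB
  have hB0 : 0 < B := by positivity
  have hΦB : ∀ t, ‖Φ t‖ ≤ B := by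
    intro t
    have h1 : Φ t = ∫ τ in t..(t + T), (F τ - F t) := by
      rw [intervalIntegral.integral_sub (hFc.intervalIntegrable _ _) (by simp)]
      rw [intervalIntegral.integral_const]
      simp only [hΦ, add_sub_cancel_left]
      congr 1
      exact intervalIntegral.integral_interval_sub_left (hFc.intervalIntegrable _ _)
        (hFc.intervalIntegrable _ _)
    rw [h1]
    have := intervalIntegral.norm_integral_le_of_norm_le_const (a := t) (b := t + T)
      (f := fun τ => F τ - F t) (C := L * T) (by
        intro τ hτ
        rw [Set.uIoc_of_le (by linarith)] at hτ
        rw [hFsub]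
        have h2 := intervalIntegral.norm_integral_le_of_norm_le_const (a := t) (b := τ)
          (f := S) (C := L) (fun s _ => hSn s)
        rw [abs_of_nonneg (by linarith [hτ.1])] at h2
        exact h2.trans (mul_le_mul_of_nonneg_left (by linarith [hτ.2]) hL0.le))
    rwa [add_sub_cancel_left, abs_of_pos hT] at this
  set κ := ‖K‖
  set ρ := ‖P‖
  have hκ : 0 ≤ κ := norm_nonneg _
  have hρ : 0 ≤ ρ := norm_nonneg _
  obtain ⟨c, hc0, hc1, hc2⟩ : ∃ c : ℝ, 0 < c ∧ T + 2 * B ^ 2 * κ ^ 2 * L / μ ≤ 2 * c ∧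
      B + 1 ≤ c * α := by
    refine ⟨max (T + 2 * B ^ 2 * κ ^ 2 * L / μ) ((B + 1) / α), ?_, ?_, ?_⟩
    · exact lt_max_of_lt_right (by positivity)
    · have h1 := le_max_left (T + 2 * B ^ 2 * κ ^ 2 * L / μ) ((B + 1) / α)
      have h2 : 0 < (T + 2 * B ^ 2 * κ ^ 2 * L / μ) := by positivity
      linarith
    · rw [← div_le_iff₀ hα]; exact le_max_right _ _
  set β := c * ρ + B with hβ
  have hβ0 : 0 < β := by positivity
  set D := (2 * β) ^ 2 / μ with hD
  have hD0 : 0 < D := by positivity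
  set b0 := min (μ / (4 * β)) a with hb0
  have hb0p : 0 < b0 := lt_min (by positivity) ha
  refine ⟨Real.sqrt (β + D / a), b0 / 2, by positivity, by positivity, ?_⟩
  intro x u A hA hx hu
  set V : ℝ → ℝ := fun t => c * ⟪P (x t), x t⟫_ℝ - ⟪Φ t (x t), x t⟫_ℝ with hV
  have hΦx : ∀ t y z, |⟪Φ t y, z⟫_ℝ| ≤ B * ‖y‖ * ‖z‖ := by
    intro t y z
    refine (abs_real_inner_le_norm _ _).trans ?_
    gcongr
    exact (Φ t).le_of_opNorm_le (hΦB t) y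
  have hPx : ∀ y z, |⟪P y, z⟫_ℝ| ≤ ρ * ‖y‖ * ‖z‖ := by
    intro y z
    refine (abs_real_inner_le_norm _ _).trans ?_
    gcongr
    exact P.le_opNorm y
  have hVlow : ∀ t, ‖x t‖ ^ 2 ≤ V t := by
    intro t
    have h1 := hP (x t)
    have h2 := (abs_le.1 (hΦx t (x t) (x t))).2
    have h3 := mul_le_mul_of_nonneg_left h1 hc0.le
    have h4 := mul_le_mul_of_nonneg_right hc2 (sq_nonneg ‖x t‖)
    simp only [hV]
    nlinarith
  have hVup : ∀ t, V t ≤ β * ‖x t‖ ^ 2 := by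
    intro t
    have h1 := (abs_le.1 (hPx (x t) (x t))).2
    have h2 := (abs_le.1 (hΦx t (x t) (x t))).1
    have h3 := mul_le_mul_of_nonneg_left h1 hc0.le
    simp only [hV, hβ]
    nlinarith
  have hVd : ∀ t, 0 ≤ t → ∃ V', HasDerivAt V V' t ∧
      V' ≤ -b0 * V t + D * A ^ 2 * Real.exp (-2 * a * t) := by
    intro t ht
    set x' := -(K (S t (x t))) + u t with hx'
    have hxd := hx t ht
    have d1 := ((P.hasFDerivAt.comp_hasDerivAt t hxd).inner ℝ hxd).const_mul c
    have d2 := (((hΦd t).clm_apply hxd).inner ℝ hxd)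
    refine ⟨_, d1.sub d2, ?_⟩
    have e1 : ⟪P (x t), x'⟫_ℝ = -⟪S t (x t), x t⟫_ℝ + ⟪P (x t), u t⟫_ℝ := by
      rw [hx', inner_add_right, inner_neg_right, hsym, hPK, real_inner_comm]
    have e2 : ⟪P x', x t⟫_ℝ = -⟪S t (x t), x t⟫_ℝ + ⟪P (x t), u t⟫_ℝ := by
      rw [hsym, real_inner_comm, e1]
    have hpe := hPE t ht (x t)
    rw [← hFsub] at hpe
    have e3 : ⟪(F (t + T) - F t - T • S t) (x t), x t⟫_ℝ
        = ⟪(F (t + T) - F t) (x t), x t⟫_ℝ - T * ⟪S t (x t), x t⟫_ℝ := by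
      rw [_root_.sub_apply, inner_sub_left, _root_.smul_apply,
        real_inner_smul_left]
    simp only [Function.comp_apply, inner_add_left] at *
    rw [e1, e2, e3]
    set q := ⟪S t (x t), x t⟫_ℝ with hqd
    set s := ‖S t (x t)‖ with hs
    have hq0 : 0 ≤ q := hq t (x t)
    have hsq : s ^ 2 ≤ L * q := hL t (x t)
    have hxn : ‖x'‖ ≤ κ * s + ‖u t‖ := by
      rw [hx']
      refine (norm_add_le _ _).trans ?_
      rw [norm_neg]
      gcongr
      exact K.le_opNorm _
    have f1 := (abs_le.1 (hΦx t (x t) x')).1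
    have f2 := (abs_le.1 (hΦx t x' (x t))).1
    have f3 := (abs_le.1 (hPx (x t) (u t))).2
    have hX : 0 ≤ ‖x t‖ := norm_nonneg _
    have hU : 0 ≤ ‖u t‖ := norm_nonneg _
    set X := ‖x t‖
    set U := ‖u t‖
    have f4 : B * X * ‖x'‖ ≤ B * X * (κ * s + U) := by gcongr
    have y1 : 2 * B * κ * X * s ≤ μ / 2 * X ^ 2 + 2 * B ^ 2 * κ ^ 2 * L / μ * q := by
      have : 2 * B * κ * X * s ≤ μ / 2 * X ^ 2 + 2 * B ^ 2 * κ ^ 2 / μ * s ^ 2 := by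
        have : 0 ≤ (μ * X - 2 * B * κ * s) ^ 2 / (2 * μ) := by positivity
        have h : (μ * X - 2 * B * κ * s) ^ 2 / (2 * μ) = μ / 2 * X ^ 2 + 2 * B ^ 2 * κ ^ 2 / μ * s ^ 2 - 2 * B * κ * X * s := by
          field_simp; ring
        linarith
      have h2 : 2 * B ^ 2 * κ ^ 2 / μ * s ^ 2 ≤ 2 * B ^ 2 * κ ^ 2 / μ * (L * q) := by gcongr
      have h3 : 2 * B ^ 2 * κ ^ 2 / μ * (L * q) = 2 * B ^ 2 * κ ^ 2 * L / μ * q := by ring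
      linarith
    have y2 : 2 * β * X * U ≤ μ / 4 * X ^ 2 + D * U ^ 2 := by
      have : 0 ≤ (μ * X - 4 * β * U) ^ 2 / (4 * μ) := by positivity
      have h : (μ * X - 4 * β * U) ^ 2 / (4 * μ) = μ / 4 * X ^ 2 + D * U ^ 2 - 2 * β * X * U := by
        rw [hD]; field_simp; ring
      linarith
    have y3 : D * U ^ 2 ≤ D * A ^ 2 * Real.exp (-2 * a * t) := by
      have h1 : U ^ 2 ≤ (A * Real.exp (-a * t)) ^ 2 := by
        have := hu t ht
        gcongr
      have h2 : (A * Real.exp (-a * t)) ^ 2 = A ^ 2 * Real.exp (-2 * a * t) := by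
        rw [mul_pow, ← Real.exp_nat_mul]; congr 2; push_cast; ring
      rw [h2] at h1
      have := mul_le_mul_of_nonneg_left h1 hD0.le
      linarith
    have y4 : b0 * V t ≤ μ / 4 * X ^ 2 := by
      calc b0 * V t ≤ b0 * (β * X ^ 2) := by gcongr; exact hVup t
        _ ≤ μ / (4 * β) * (β * X ^ 2) := by gcongr; exact min_le_left _ _
        _ = _ := by field_simp
    have y5 := mul_le_mul_of_nonneg_right hc1 hq0
    have y6 := mul_le_mul_of_nonneg_left f3 hc0.le
    have hβe : 2 * β * X * U = 2 * (c * (ρ * X * U)) + 2 * (B * X * U) := by rw [hβ]; ring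
    linarith
  -- integrate
  set Y : ℝ → ℝ := fun t => Real.exp (b0 * t) * V t + D * A ^ 2 / a * Real.exp (-a * t) with hY
  have hYd : ∀ t, 0 ≤ t → ∃ Y', HasDerivAt Y Y' t ∧ Y' ≤ 0 := by
    intro t ht
    obtain ⟨V', hV', hle⟩ := hVd t ht
    have g1 : HasDerivAt (fun t => Real.exp (b0 * t)) (Real.exp (b0 * t) * (b0 * 1)) t :=
      ((hasDerivAt_id t).const_mul b0).exp
    have g2 : HasDerivAt (fun t => Real.exp (-a * t)) (Real.exp (-a * t) * (-a * 1)) t :=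
      ((hasDerivAt_id t).const_mul (-a)).exp
    refine ⟨_, (g1.mul hV').add (g2.const_mul (D * A ^ 2 / a)), ?_⟩
    have h1 : Real.exp (b0 * t) * V' ≤ Real.exp (b0 * t) * (-b0 * V t + D * A ^ 2 * Real.exp (-2 * a * t)) := by
      gcongr
    have h2 : Real.exp (b0 * t) * Real.exp (-2 * a * t) ≤ Real.exp (-a * t) := by
      rw [← Real.exp_add]
      apply Real.exp_le_exp.2
      have : b0 * t ≤ a * t := by gcongr; exact min_le_right _ _
      linarith
    have h3 : D * A ^ 2 * (Real.exp (b0 * t) * Real.exp (-2 * a * t)) ≤ D * A ^ 2 * Real.exp (-a * t) := by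
      gcongr
    have h4 : D * A ^ 2 / a * (Real.exp (-a * t) * (-a * 1)) = - (D * A ^ 2 * Real.exp (-a * t)) := by
      field_simp
    rw [h4]
    linarith
  have hanti : AntitoneOn Y (Set.Ici 0) := by
    apply antitoneOn_of_deriv_nonpos (convex_Ici 0)
    · intro t ht
      obtain ⟨Y', h, _⟩ := hYd t ht
      exact h.continuousAt.continuousWithinAt
    · intro t ht
      rw [interior_Ici] at ht
      obtain ⟨Y', h, _⟩ := hYd t (le_of_lt ht)
      exact h.differentiableAt.differentiableWithinAt
    · intro t ht
      rw [interior_Ici] at ht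
      obtain ⟨Y', h, h'⟩ := hYd t (le_of_lt ht)
      rw [h.deriv]; exact h'
  intro t ht
  have hfin := hanti (Set.mem_Ici.2 le_rfl) (Set.mem_Ici.2 ht) ht
  simp only [hY, mul_zero, Real.exp_zero, one_mul, mul_one] at hfin
  have h0 := hVup 0
  have ht' := hVlow t
  have k1 : Real.exp (b0 * t) * ‖x t‖ ^ 2 ≤ (β + D / a) * (‖x 0‖ + A) ^ 2 := by
    have l1 : Real.exp (b0 * t) * ‖x t‖ ^ 2 ≤ Real.exp (b0 * t) * V t := by gcongr
    have l2 : 0 ≤ D * A ^ 2 / a * Real.exp (-a * t) := by positivity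
    have l3 : β * ‖x 0‖ ^ 2 ≤ β * (‖x 0‖ + A) ^ 2 := by gcongr; linarith
    have l4 : D / a * A ^ 2 ≤ D / a * (‖x 0‖ + A) ^ 2 := by
      gcongr; linarith [norm_nonneg (x 0)]
    have l5 : D * A ^ 2 / a = D / a * A ^ 2 := by ring
    linarith
  refine (pow_le_pow_iff_left₀ (norm_nonneg _) (by positivity) two_ne_zero).1 ?_
  rw [mul_pow, mul_pow, Real.sq_sqrt (by positivity), ← Real.exp_nat_mul]
  have k2 : ((2:ℕ):ℝ) * (-(b0 / 2) * t) = -(b0 * t) := by push_cast; ring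
  rw [k2, Real.exp_neg, ← div_eq_mul_inv, le_div_iff₀ (Real.exp_pos _)]
  linarith

abbrev E3 := EuclideanSpace ℝ (Fin 3)

theorem euclNorm_eq (x : Fin 3 → ℝ) : euclNorm x = ‖(WithLp.toLp 2 x : E3)‖ := by
  rw [EuclideanSpace.norm_eq, euclNorm]
  congr 1
  refine Finset.sum_congr rfl fun i _ => ?_
  simp [sq]

/-- The projector as a continuous linear map. -/
def projL (g : E3) : E3 →L[ℝ] E3 := ContinuousLinearMap.id ℝ E3 - (innerSL ℝ g).smulRight g

theorem projL_apply (g x : E3) : projL g x = x - inner ℝ g x • g := by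
  simp [projL]

theorem toLp_proj (g x : Fin 3 → ℝ) :
    (WithLp.toLp 2 ((proj g).mulVec x) : E3) = projL (WithLp.toLp 2 g) (WithLp.toLp 2 x) := by
  rw [projL_apply]
  ext i
  simp [proj, Matrix.sub_mulVec, Matrix.vecMulVec_mulVec, PiLp.inner_apply, dotProduct, mul_comm]

theorem projL_sq (g x : E3) (hg : ‖g‖ = 1) : ‖projL g x‖ ^ 2 = inner ℝ (projL g x) x := by
  rw [projL_apply, ← real_inner_self_eq_norm_sq]
  simp only [inner_sub_left, inner_sub_right, real_inner_smul_left, real_inner_smul_right]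
  rw [real_inner_self_eq_norm_sq g, hg, real_inner_comm x g]
  ring

theorem projL_le (g x : E3) (hg : ‖g‖ = 1) : ‖projL g x‖ ≤ ‖x‖ := by
  have h1 := projL_sq g x hg
  have h2 := real_inner_le_norm (projL g x) x
  by_contra h
  push Not at h
  have : 0 < ‖projL g x‖ := lt_of_le_of_lt (norm_nonneg _) h
  nlinarith

theorem continuous_projL : Continuous projL := by
  unfold projL
  have : Continuous fun g : E3 => (innerSL ℝ g).smulRight g := by
    have h : (fun g : E3 => (innerSL ℝ g).smulRight g) = fun g : E3 =>
        ContinuousLinearMap.smulRightL ℝ E3 E3 (innerSL ℝ g) g := by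
      ext; simp
    rw [h]
    fun_prop
  fun_prop

theorem sum_projL_sq {ι : Type*} (s : Finset ι) (g : ι → E3) (hg : ∀ j ∈ s, ‖g j‖ = 1) (x : E3) :
    ‖(∑ j ∈ s, projL (g j)) x‖ ^ 2 ≤ ((s.card : ℝ) + 1) * inner ℝ ((∑ j ∈ s, projL (g j)) x) x := by
  rw [_root_.sum_apply, sum_inner]
  have h1 : ∑ j ∈ s, inner ℝ (projL (g j) x) x = ∑ j ∈ s, ‖projL (g j) x‖ ^ 2 :=
    Finset.sum_congr rfl fun j hj => (projL_sq _ _ (hg j hj)).symm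
  rw [h1]
  have h2 : ‖∑ j ∈ s, projL (g j) x‖ ^ 2 ≤ (∑ j ∈ s, ‖projL (g j) x‖) ^ 2 := by
    gcongr
    exact norm_sum_le _ _
  have h3 := sq_sum_le_card_mul_sum_sq (s := s) (f := fun j => ‖projL (g j) x‖)
  have h4 : 0 ≤ ∑ j ∈ s, ‖projL (g j) x‖ ^ 2 := Finset.sum_nonneg fun _ _ => sq_nonneg _
  linarith

theorem coercive_of_pos (P : E3 →L[ℝ] E3) (hP : ∀ x, x ≠ 0 → 0 < inner ℝ (P x) x) :
    ∃ α : ℝ, 0 < α ∧ ∀ x, α * ‖x‖ ^ 2 ≤ inner ℝ (P x) x := by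
  have hc : Continuous fun x : E3 => inner ℝ (P x) x := by fun_prop
  obtain ⟨z, hz, hmin⟩ := (isCompact_sphere (0 : E3) 1).exists_isMinOn
    (NormedSpace.sphere_nonempty.2 zero_le_one) hc.continuousOn
  have hz1 : ‖z‖ = 1 := by simpa using hz
  have hz0 : z ≠ 0 := by rintro rfl; simp at hz1
  refine ⟨_, hP z hz0, fun x => ?_⟩
  by_cases hx : x = 0
  · simp [hx]
  have hxn : 0 < ‖x‖ := norm_pos_iff.2 hx
  have h := hmin (a := ‖x‖⁻¹ • x) (by simp [norm_smul, hxn.ne'])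
  simp only [Set.mem_ofPred_eq, map_smul, real_inner_smul_left, real_inner_smul_right] at h
  calc _ ≤ (‖x‖⁻¹ * (‖x‖⁻¹ * inner ℝ (P x) x)) * ‖x‖ ^ 2 := by gcongr
    _ = _ := by field_simp

theorem toLp_mulVec (K : Matrix (Fin 3) (Fin 3) ℝ) (x : Fin 3 → ℝ) :
    (WithLp.toLp 2 (K.mulVec x) : E3) = Matrix.toEuclideanCLM (𝕜 := ℝ) K (WithLp.toLp 2 x) := by
  simp

theorem inner_toLp (x y : Fin 3 → ℝ) :
    inner ℝ (WithLp.toLp 2 x : E3) (WithLp.toLp 2 y) = y ⬝ᵥ x := by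
  simp [PiLp.inner_apply, dotProduct]

theorem hasDerivAt_toLp {f : ℝ → Fin 3 → ℝ} {f' : Fin 3 → ℝ} {t : ℝ} (h : HasDerivAt f f' t) :
    HasDerivAt (fun t => (WithLp.toLp 2 (f t) : E3)) (WithLp.toLp 2 f') t :=
  (PiLp.continuousLinearEquiv 2 ℝ (fun _ : Fin 3 => ℝ)).symm.toContinuousLinearMap.hasFDerivAt.comp_hasDerivAt
    t h

theorem bearing_norm {n : ℕ} (p : Fin n → ℝ → (Fin 3 → ℝ)) (i j : Fin n) (t : ℝ)
    (h : p i t ≠ p j t) : ‖(WithLp.toLp 2 (bearing p i j t) : E3)‖ = 1 := by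
  have h0 : ‖(WithLp.toLp 2 (p j t - p i t) : E3)‖ ≠ 0 := by
    rw [norm_ne_zero_iff]
    intro h'
    apply h
    have := congrArg (WithLp.ofLp) h'
    simp only [WithLp.ofLp_zero] at this
    exact (sub_eq_zero.1 this).symm
  rw [bearing, euclNorm_eq, WithLp.toLp_smul, norm_smul, norm_inv, norm_norm, inv_mul_cancel₀ h0]

theorem proj_bearing {n : ℕ} (p : Fin n → ℝ → (Fin 3 → ℝ)) (i j : Fin n) (t : ℝ)
    (h : p i t ≠ p j t) : projL (WithLp.toLp 2 (bearing p i j t)) (WithLp.toLp 2 (p j t - p i t)) = 0 := by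
  have hg := bearing_norm p i j t h
  set g : E3 := WithLp.toLp 2 (bearing p i j t) with hgd
  have h0 : ‖(WithLp.toLp 2 (p j t - p i t) : E3)‖ ≠ 0 := by
    intro h'
    rw [hgd, bearing, euclNorm_eq, WithLp.toLp_smul, norm_smul, h'] at hg
    simp at hg
  have : (WithLp.toLp 2 (p j t - p i t) : E3) = ‖(WithLp.toLp 2 (p j t - p i t) : E3)‖ • g := by
    rw [hgd, bearing, euclNorm_eq, WithLp.toLp_smul, smul_smul, mul_inv_cancel₀ h0, one_smul]
  rw [this, map_smul, projL_apply, real_inner_self_eq_norm_sq, hg]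
  simp

theorem continuous_bearing {n : ℕ} (p v : Fin n → ℝ → (Fin 3 → ℝ))
    (hderiv : ∀ i, ∀ t : ℝ, 0 ≤ t → HasDerivAt (p i) (v i t) t) (i j : Fin n)
    (h : ∀ t : ℝ, 0 ≤ t → p i t ≠ p j t) :
    Continuous fun t : ℝ => (WithLp.toLp 2 (bearing p i j (max t 0)) : E3) := by
  have hp : ∀ i, Continuous fun t : ℝ => p i (max t 0) := by
    intro i
    rw [continuous_iff_continuousAt]
    intro t
    have := (hderiv i (max t 0) (le_max_right _ _)).continuousAt
    exact ContinuousAt.comp (f := fun t : ℝ => max t 0) this (by fun_prop)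
  have hd : Continuous fun t : ℝ => (WithLp.toLp 2 (p j (max t 0) - p i (max t 0)) : E3) :=
    (PiLp.continuous_toLp 2 _).comp ((hp j).sub (hp i))
  simp only [bearing, WithLp.toLp_smul, euclNorm_eq]
  refine (Continuous.inv₀ hd.norm ?_).smul hd
  intro t h0
  have hg := bearing_norm p i j (max t 0) (h _ (le_max_right _ _))
  rw [bearing, euclNorm_eq, WithLp.toLp_smul, norm_smul, h0] at hg
  simp at hg

theorem agent {n : ℕ} (N : Finset (Fin n)) (i : Fin n)
    (p v : Fin n → ℝ → (Fin 3 → ℝ))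
    (hderiv : ∀ i, ∀ t : ℝ, 0 ≤ t → HasDerivAt (p i) (v i t) t)
    (hwell : ∀ j ∈ N, ∀ t : ℝ, 0 ≤ t → p i t ≠ p j t)
    (hbPE : IsPE (fun t => ∑ j ∈ N, proj (bearing p i j t)))
    (K : Matrix (Fin 3) (Fin 3) ℝ) (hK : K.PosDef) (a : ℝ) (ha : 0 < a) :
    ∃ C b : ℝ, 0 < C ∧ 0 < b ∧ ∀ (x u : ℝ → E3) (A : ℝ), 0 ≤ A →
      (∀ t, 0 ≤ t → HasDerivAt x (-(Matrix.toEuclideanCLM (𝕜 := ℝ) K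
        ((∑ j ∈ N, projL (WithLp.toLp 2 (bearing p i j t))) (x t))) + u t) t) →
      (∀ t, 0 ≤ t → ‖u t‖ ≤ A * Real.exp (-a * t)) →
      ∀ t, 0 ≤ t → ‖x t‖ ≤ C * (‖x 0‖ + A) * Real.exp (-b * t) := by
  set S : ℝ → E3 →L[ℝ] E3 := fun t => ∑ j ∈ N, projL (WithLp.toLp 2 (bearing p i j (max t 0))) with hSd
  have hS : Continuous S := continuous_finsetSum _ fun j hj =>
    continuous_projL.comp (continuous_bearing p v hderiv i j (hwell j hj))
  obtain ⟨T, μ, hT, hμ, hpe⟩ := hbPE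
  have hKi := hK.inv
  have hdet : IsUnit K.det := (Matrix.isUnit_iff_isUnit_det K).1 hK.isUnit
  obtain ⟨α, hα, hcoer⟩ := coercive_of_pos (Matrix.toEuclideanCLM (𝕜 := ℝ) K⁻¹) (by
    intro x hx
    have hx' : x.ofLp ≠ 0 := by
      intro h; apply hx; ext i; simp [h]
    have := hKi.dotProduct_mulVec_pos hx'
    have e : x = WithLp.toLp 2 x.ofLp := rfl
    rw [e, ← toLp_mulVec, inner_toLp]
    simpa using this)
  obtain ⟨C, b, hC, hb, hmain⟩ := core_aux S hS ((N.card : ℝ) + 1) (by positivity)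
    (fun t x => sum_projL_sq N _ (fun j hj => bearing_norm p i j _ (hwell j hj _ (le_max_right _ _))) x)
    T (T * μ) hT (by positivity) (by
      intro t ht x
      have h := (hpe t ht).dotProduct_mulVec_nonneg x.ofLp
      have hint : ∀ y : E3, (∫ τ in t..(t + T), S τ) y = ∫ τ in t..(t + T), S τ y := by
        intro y
        exact (ContinuousLinearMap.intervalIntegral_apply (hS.intervalIntegrable _ _) y)
      have hval : (∫ τ in t..(t + T), S τ) x = WithLp.toLp 2 ((Matrix.of fun i' j' =>
          ∫ τ in t..(t + T), (∑ j ∈ N, proj (bearing p i j τ)) i' j').mulVec x.ofLp) := by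
        ext k
        have hSx : Continuous fun τ => S τ x := by fun_prop
        rw [hint]
        have e1 : (∫ τ in t..(t + T), S τ x) k = ∫ τ in t..(t + T), S τ x k :=
          ((EuclideanSpace.proj k : E3 →L[ℝ] ℝ).intervalIntegral_comp_comm
            (hSx.intervalIntegrable t (t + T))).symm
        rw [e1]
        have e2 : ∀ τ, 0 ≤ τ → ∀ y : E3, S τ y = WithLp.toLp 2
            ((∑ j ∈ N, proj (bearing p i j τ)).mulVec y.ofLp) := by
          intro τ hτ y
          rw [hSd]
          simp only [max_eq_left hτ, Matrix.sum_mulVec, WithLp.toLp_sum, toLp_proj]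
          rw [_root_.sum_apply]
        have e3 : ∀ i' j', IntervalIntegrable
            (fun τ => (∑ j ∈ N, proj (bearing p i j τ)) i' j') volume t (t + T) := by
          intro i' j'
          have : Continuous fun τ => S τ (EuclideanSpace.single j' 1) i' := by fun_prop
          refine (this.intervalIntegrable t (t + T)).congr ?_
          intro τ hτ
          rw [Set.uIoc_of_le (by linarith)] at hτ
          simp only
          rw [e2 τ (ht.trans hτ.1.le)]
          simp
        simp only [Matrix.mulVec, dotProduct, Matrix.of_apply]
        have e4 : ∀ j', (∫ τ in t..(t + T), (∑ j ∈ N, proj (bearing p i j τ)) k j') * x.ofLp j'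
            = ∫ τ in t..(t + T), (∑ j ∈ N, proj (bearing p i j τ)) k j' * x.ofLp j' := fun j' =>
          (intervalIntegral.integral_mul_const _ _).symm
        simp only [e4]
        rw [← intervalIntegral.integral_finsetSum (fun j' _ => (e3 k j').mul_const _)]
        refine intervalIntegral.integral_congr fun τ hτ => ?_
        rw [Set.uIcc_of_le (by linarith)] at hτ
        beta_reduce
        rw [e2 τ (ht.trans hτ.1)]
        rfl
      rw [hval]
      have e : x = WithLp.toLp 2 x.ofLp := rfl
      have e5 : ‖x‖ ^ 2 = x.ofLp ⬝ᵥ x.ofLp := by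
        rw [← real_inner_self_eq_norm_sq, e, inner_toLp]
      rw [e5]
      nth_rw 4 [e]
      rw [inner_toLp]
      simp only [star_trivial, Matrix.sub_mulVec, Matrix.smul_mulVec, Matrix.one_mulVec,
        dotProduct_sub, dotProduct_smul, smul_eq_mul] at h
      have h2 := mul_le_mul_of_nonneg_left (sub_nonneg.1 h) hT.le
      rw [mul_inv_cancel_left₀ hT.ne'] at h2
      linarith)
    (Matrix.toEuclideanCLM (𝕜 := ℝ) K) (Matrix.toEuclideanCLM (𝕜 := ℝ) K⁻¹)
    (by
      intro x y
      have ex : x = WithLp.toLp 2 x.ofLp := rfl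
      have ey : y = WithLp.toLp 2 y.ofLp := rfl
      rw [ex, ey, ← toLp_mulVec, ← toLp_mulVec, inner_toLp, inner_toLp]
      have hs : (K⁻¹)ᵀ = K⁻¹ := by simpa using hKi.isHermitian.eq
      rw [Matrix.dotProduct_mulVec, ← Matrix.mulVec_transpose, hs])
    (by
      intro x
      rw [← mul_apply_eq_comp, ← map_mul, Matrix.nonsing_inv_mul _ hdet, map_one]
      rfl)
    α hα hcoer a ha
  refine ⟨C, b, hC, hb, fun x u A hA hx hu => hmain x u A hA (fun t ht => ?_) hu⟩
  have := hx t ht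
  simpa only [hSd, max_eq_left ht] using this

/-- bearing-PE leader-follower observer. For a bearing persistently exciting
leader-follower formation with bounded positions and velocities, the observer
`p̂̇_i = v_i − K Σ_{j∈N_i} π_{g_ij}(p̂_i − p̂_j)`, `p̂_1 ≡ p_1`, makes every estimation error
`p̃_i = p̂_i − p_i` converge to zero uniformly globally exponentially. -/
theorem stmt2
    (n : ℕ) (hn : 2 ≤ n) (N : Fin n → Finset (Fin n)) (hLF : LeaderFollower N)
    (p v : Fin n → ℝ → (Fin 3 → ℝ))
    (hderiv : ∀ i, ∀ t : ℝ, 0 ≤ t → HasDerivAt (p i) (v i t) t)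
    (hbounded : ∃ M : ℝ, ∀ i, ∀ t : ℝ, 0 ≤ t → euclNorm (p i t) ≤ M ∧ euclNorm (v i t) ≤ M)
    (hwell : ∀ i, ∀ j ∈ N i, ∀ t : ℝ, 0 ≤ t → p i t ≠ p j t)
    (hbPE : ∀ i : Fin n, (i : ℕ) ≠ 0 →
      IsPE (fun t => ∑ j ∈ N i, proj (bearing p i j t)))
    (K : Matrix (Fin 3) (Fin 3) ℝ) (hK : K.PosDef) :
    ∃ k lam : ℝ, 0 < k ∧ 0 < lam ∧
      ∀ phat : Fin n → ℝ → (Fin 3 → ℝ),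
        (∀ t : ℝ, 0 ≤ t → ∀ i : Fin n, (i : ℕ) = 0 → phat i t = p i t) →
        (∀ i : Fin n, (i : ℕ) ≠ 0 → ∀ t : ℝ, 0 ≤ t →
          HasDerivAt (phat i)
            (v i t - K.mulVec ((∑ j ∈ N i, proj (bearing p i j t)).mulVec
              (phat i t) - ∑ j ∈ N i, (proj (bearing p i j t)).mulVec (phat j t))) t) →
        ∀ i : Fin n, (i : ℕ) ≠ 0 → ∀ t : ℝ, 0 ≤ t →
          euclNorm (phat i t - p i t) ≤
            k * (∑ j ∈ Finset.univ.filter (fun j : Fin n => (j : ℕ) ≠ 0),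
              euclNorm (phat j 0 - p j 0)) * Real.exp (-lam * t) := by
  have hlt : ∀ i : Fin n, ∀ j ∈ N i, (j : ℕ) < (i : ℕ) := by
    intro i j hj
    obtain ⟨h0, h1, h2⟩ := hLF
    rcases Nat.lt_or_ge (i : ℕ) 2 with h | h
    · rcases Nat.lt_or_ge (i : ℕ) 1 with h' | h'
      · rw [h0 i (by omega)] at hj
        simp at hj
      · have hi : (i : ℕ) = 1 := by omega
        rw [h1 i hi, Finset.mem_singleton] at hj
        rw [hj, hi]
        exact Nat.zero_lt_one
    · exact (h2 i h).2 j hj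
  have key : ∀ m : ℕ, ∃ k lam : ℝ, 0 < k ∧ 0 < lam ∧
      ∀ phat : Fin n → ℝ → (Fin 3 → ℝ),
        (∀ t : ℝ, 0 ≤ t → ∀ i : Fin n, (i : ℕ) = 0 → phat i t = p i t) →
        (∀ i : Fin n, (i : ℕ) ≠ 0 → ∀ t : ℝ, 0 ≤ t →
          HasDerivAt (phat i)
            (v i t - K.mulVec ((∑ j ∈ N i, proj (bearing p i j t)).mulVec
              (phat i t) - ∑ j ∈ N i, (proj (bearing p i j t)).mulVec (phat j t))) t) →
        ∀ i : Fin n, (i : ℕ) < m → ∀ t : ℝ, 0 ≤ t →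
          euclNorm (phat i t - p i t) ≤
            k * (∑ j ∈ Finset.univ.filter (fun j : Fin n => (j : ℕ) ≠ 0),
              euclNorm (phat j 0 - p j 0)) * Real.exp (-lam * t) := by
    intro m
    induction m with
    | zero => exact ⟨1, 1, one_pos, one_pos, fun _ _ _ i hi => absurd hi (Nat.not_lt_zero _)⟩
    | succ m ih =>
      obtain ⟨k, lam, hk, hlam, ih⟩ := ih
      have hsum : ∀ phat : Fin n → ℝ → (Fin 3 → ℝ),
          0 ≤ ∑ j ∈ Finset.univ.filter (fun j : Fin n => (j : ℕ) ≠ 0),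
              euclNorm (phat j 0 - p j 0) := fun phat =>
        Finset.sum_nonneg fun j _ => Real.sqrt_nonneg _
      by_cases hm : 0 < m ∧ m < n
      · obtain ⟨hm0, hmn⟩ := hm
        set i : Fin n := ⟨m, hmn⟩ with hi
        have hi0 : (i : ℕ) ≠ 0 := by rw [hi]; exact hm0.ne'
        obtain ⟨C, b, hC, hb, hag⟩ := agent (N i) i p v hderiv (hwell i) (hbPE i hi0) K hK lam hlam
        set KL := Matrix.toEuclideanCLM (𝕜 := ℝ) K with hKL
        set c1 := ‖KL‖ * ((N i).card * k) with hc1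
        have hc1n : 0 ≤ c1 := by positivity
        refine ⟨max k (C * (1 + c1)), min lam b, lt_max_of_lt_left hk, lt_min hlam hb, ?_⟩
        intro phat hp0 hph i' hi' t ht
        set E0 := ∑ j ∈ Finset.univ.filter (fun j : Fin n => (j : ℕ) ≠ 0),
              euclNorm (phat j 0 - p j 0) with hE0
        have hE0n : 0 ≤ E0 := hsum phat
        have hIH := ih phat hp0 hph
        rcases Nat.lt_or_ge (i' : ℕ) m with hlt' | hge
        · refine (hIH i' hlt' t ht).trans ?_
          gcongr
          · exact le_max_left _ _
          · exact min_le_left _ _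
        · have hii : i' = i := by
            apply Fin.ext
            have : (i : ℕ) = m := rfl
            omega
          rw [hii]
          have hfin := hag (fun t => WithLp.toLp 2 (phat i t - p i t))
            (fun t => KL (∑ j ∈ N i, projL (WithLp.toLp 2 (bearing p i j t))
              (WithLp.toLp 2 (phat j t - p j t)))) (c1 * E0) (by positivity)
            (by
              intro t ht
              have hd := hasDerivAt_toLp ((hph i hi0 t ht).sub (hderiv i t ht))
              refine HasDerivAt.congr_deriv (f := fun t => (WithLp.toLp 2 (phat i t - p i t) : E3)) hd ?_
              symm
              have hz : ∀ j ∈ N i, projL (WithLp.toLp 2 (bearing p i j t))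
                  (WithLp.toLp 2 (p j t)) = projL (WithLp.toLp 2 (bearing p i j t))
                  (WithLp.toLp 2 (p i t)) := by
                intro j hj
                have := proj_bearing p i j t (hwell i j hj t ht)
                rw [WithLp.toLp_sub, map_sub, sub_eq_zero] at this
                exact this
              have e1 : v i t - K.mulVec ((∑ j ∈ N i, proj (bearing p i j t)).mulVec
                  (phat i t) - ∑ j ∈ N i, (proj (bearing p i j t)).mulVec (phat j t)) - v i t
                  = - K.mulVec ((∑ j ∈ N i, proj (bearing p i j t)).mulVec
                  (phat i t) - ∑ j ∈ N i, (proj (bearing p i j t)).mulVec (phat j t)) := by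
                abel
              rw [e1, WithLp.toLp_neg, toLp_mulVec, ← hKL, Matrix.sum_mulVec]
              simp only [WithLp.toLp_sub]
              rw [WithLp.toLp_sum, WithLp.toLp_sum, neg_add_eq_sub, eq_neg_iff_add_eq_zero, ← map_sub KL,
                ← map_add KL]
              refine (congrArg KL ?_).trans (map_zero KL)
              rw [_root_.sum_apply, ← Finset.sum_sub_distrib, ← Finset.sum_sub_distrib,
                ← Finset.sum_add_distrib]
              refine Finset.sum_eq_zero fun j hj => ?_
              rw [toLp_proj, toLp_proj, map_sub, map_sub, hz j hj]
              abel)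
            (by
              intro t ht
              refine (KL.le_opNorm _).trans ?_
              have hs : ‖∑ j ∈ N i, projL (WithLp.toLp 2 (bearing p i j t))
                  (WithLp.toLp 2 (phat j t - p j t))‖
                  ≤ (N i).card * (k * E0 * Real.exp (-lam * t)) := by
                refine (norm_sum_le _ _).trans ?_
                rw [← nsmul_eq_mul]
                refine Finset.sum_le_card_nsmul _ _ _ fun j hj => ?_
                refine (projL_le _ _ (bearing_norm p i j t (hwell i j hj t ht))).trans ?_
                rw [← euclNorm_eq]
                exact hIH j (hlt i j hj) t ht
              calc _ ≤ ‖KL‖ * ((N i).card * (k * E0 * Real.exp (-lam * t))) := by gcongr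
                _ = _ := by rw [hc1]; ring)
            t ht
          simp only [← euclNorm_eq] at hfin
          refine hfin.trans ?_
          have h0 : euclNorm (phat i 0 - p i 0) ≤ E0 :=
            Finset.single_le_sum (f := fun j => euclNorm (phat j 0 - p j 0))
              (fun j _ => Real.sqrt_nonneg _) (by simp [hi0])
          calc _ ≤ C * (E0 + c1 * E0) * Real.exp (-b * t) := by gcongr
            _ = (C * (1 + c1)) * E0 * Real.exp (-b * t) := by ring
            _ ≤ _ := by
              gcongr
              · exact le_max_right _ _
              · exact min_le_right _ _
      · refine ⟨k, lam, hk, hlam, ?_⟩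
        intro phat hp0 hph i' hi' t ht
        rcases Nat.lt_or_ge (i' : ℕ) m with hlt' | hge
        · exact ih phat hp0 hph i' hlt' t ht
        · have h0 : (i' : ℕ) = 0 := by
            have := i'.isLt
            omega
          rw [hp0 t ht i' h0, sub_self]
          have hz : euclNorm (0 : Fin 3 → ℝ) = 0 := by simp [euclNorm]
          rw [hz]
          have := hsum phat
          positivity
  obtain ⟨k, lam, hk, hlam, h⟩ := key n
  exact ⟨k, lam, hk, hlam, fun phat h0 h1 i _ t ht => h phat h0 h1 i i.isLt t ht⟩
end
end

section
/- Consider two agents, a leader (agent 1) and a first follower (agent 2), with double-integrator dynamics ṗ_i = v_i, v̇_i = u_i, the follower applying the control u_2 = −k_{p_2} π_{g_{21}(t)} p*_{21}(t) + k_{d_2} ṽ_{21}(t) + u*_2(t), where the gains satisfy k_{d_2} > 1 and 0 < k_{p_2} < 4 − 4/k_{d_2}². Assume: the desired acceleration u*_i(t) and desired relative velocity v*_{21}(t) are bounded; the desired bearing g*_{21}(t) is well-defined for all t and is persistently exciting; and the actual bearing g_{21}(t) is well-defined for all t along the closed-loop solution (no collision/occlusion). Then the equilibrium x̃_{21} =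 (p̃_{21}, ṽ_{21}) = 0 of the closed-loop error dynamics ẋ̃_{21} = −A_2(g_{21}(t)) x̃_{21} is exponentially stable: there exist k, λ > 0 (possibly depending on ‖x̃_{21}(0)‖) such that ‖x̃_{21}(t)‖ ≤ k ‖x̃_{21}(0)‖ e^{−λ t} for all t ≥ 0. -/
open Matrix MeasureTheory

noncomputable section

/-- Unit vector in the direction of `x`. -/
def unitize (x : Fin 3 → ℝ) : Fin 3 → ℝ := (euclNorm x)⁻¹ • x

/-- A time-varying positive semidefinite matrix is PE with constants `T, μ`. -/
def IsPEWith {ι : Type*} [Fintype ι] [DecidableEq ι]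
    (M : ℝ → Matrix ι ι ℝ) (T μ : ℝ) : Prop :=
  0 < T ∧ 0 < μ ∧
    ∀ t : ℝ, 0 ≤ t →
      ((T⁻¹ • Matrix.of fun i j => ∫ τ in t..(t + T), M τ i j) -
        μ • (1 : Matrix ι ι ℝ)).PosSemidef

/-- Discrete-time decay to exponential decay. -/
lemma aux_iter (L : ℝ → ℝ) (T K : ℝ) (hT : 0 < T) (hK : 1 < K)
    (hL0 : ∀ t, 0 ≤ t → 0 ≤ L t)
    (hanti : ∀ s t, 0 ≤ s → s ≤ t → L t ≤ L s)
    (hdec : ∀ t, 0 ≤ t → L t ≤ K * (L t - L (t + T))) :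
    ∃ k lam : ℝ, 0 < k ∧ 0 < lam ∧ ∀ t, 0 ≤ t → L t ≤ k * L 0 * Real.exp (-lam * t) := by
  have hK0 : 0 < K := by linarith
  set ρ : ℝ := 1 - 1 / K with hρ
  have hρ1 : ρ < 1 := by
    have : 0 < 1 / K := by positivity
    linarith
  have hρ0 : 0 < ρ := by
    have : 1 / K < 1 := by rw [div_lt_one hK0]; exact hK
    linarith
  have hstep : ∀ t, 0 ≤ t → L (t + T) ≤ ρ * L t := by
    intro t ht
    have h := hdec t ht
    have h2 : L t / K ≤ L t - L (t + T) := by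
      rw [div_le_iff₀ hK0]; linarith
    have h3 : ρ * L t = L t - L t / K := by rw [hρ]; ring
    linarith
  have hn : ∀ n : ℕ, L (n * T) ≤ ρ ^ n * L 0 := by
    intro n
    induction n with
    | zero => simp
    | succ n ih =>
      have h := hstep (n * T) (by positivity)
      have e : ((n + 1 : ℕ) : ℝ) * T = n * T + T := by push_cast; ring
      rw [e, pow_succ]
      have := mul_le_mul_of_nonneg_left ih hρ0.le
      linarith
  have ha : Real.log ρ < 0 := Real.log_neg hρ0 hρ1
  refine ⟨Real.exp (-Real.log ρ), -Real.log ρ / T, Real.exp_pos _,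
    div_pos (by linarith) hT, ?_⟩
  intro t ht
  set n := ⌊t / T⌋₊ with hnn
  have h1 : (n : ℝ) ≤ t / T := Nat.floor_le (by positivity)
  have h2 : t / T < n + 1 := Nat.lt_floor_add_one _
  have h3 : (n : ℝ) * T ≤ t := by rwa [le_div_iff₀ hT] at h1
  have h4 := hanti (n * T) t (by positivity) h3
  have h5 := hn n
  have h6 : ρ ^ n ≤ Real.exp (-Real.log ρ) * Real.exp (-(-Real.log ρ / T) * t) := by
    have e : ρ ^ n = Real.exp (n * Real.log ρ) := by
      rw [Real.exp_nat_mul, Real.exp_log hρ0]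
    rw [e, ← Real.exp_add]
    apply Real.exp_le_exp.mpr
    have e2 : -(-Real.log ρ / T) * t = Real.log ρ * (t / T) := by ring
    rw [e2]
    nlinarith
  have h7 := mul_le_mul_of_nonneg_right h6 (hL0 0 le_rfl)
  calc L t ≤ ρ ^ n * L 0 := h4.trans h5
    _ ≤ _ := h7
    _ = _ := by ring

/-- A quadratic form with negative discriminant is uniformly definite. -/
lemma aux_quad (a b c : ℝ) (ha : 0 < a) (hb : 0 < b) (hc0 : 0 ≤ c) (hc : c ^ 2 < 4 * a * b) :
    ∃ ε : ℝ, 0 < ε ∧ ∀ X Y Z : ℝ, |Z| ≤ X * Y →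
      -a * X ^ 2 - b * Y ^ 2 - c * Z ≤ -ε * (X ^ 2 + Y ^ 2) := by
  have hab : 0 < a + b := by linarith
  refine ⟨(a * b - c ^ 2 / 4) / (a + b), div_pos (by linarith) hab, ?_⟩
  intro X Y Z hZ
  set ε := (a * b - c ^ 2 / 4) / (a + b) with hε
  have h1 : ε * (a + b) = a * b - c ^ 2 / 4 := by rw [hε]; field_simp
  have h0 : 0 < ε := div_pos (by linarith) hab
  have h2 : 0 < a - ε := by
    by_contra h
    push Not at h
    nlinarith [sq_nonneg c]
  have h4 : -Z ≤ X * Y := (neg_le_abs Z).trans hZ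
  have h5 : -(c * Z) ≤ c * (X * Y) := by nlinarith
  have h6 : (a - ε) * ((a - ε) * X ^ 2 + (b - ε) * Y ^ 2 - c * (X * Y)) ≥ 0 := by
    have : (a - ε) * ((a - ε) * X ^ 2 + (b - ε) * Y ^ 2 - c * (X * Y))
      = ((a - ε) * X - c / 2 * Y) ^ 2 + ε ^ 2 * Y ^ 2 := by
        linear_combination (-Y ^ 2) * h1
    rw [this]; positivity
  have h7 : 0 ≤ (a - ε) * X ^ 2 + (b - ε) * Y ^ 2 - c * (X * Y) :=
    nonneg_of_mul_nonneg_right h6 h2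
  nlinarith

/-- Monotonicity from a derivative sign on an interval. -/
lemma aux_anti (f f' : ℝ → ℝ) (a b : ℝ) (hab : a ≤ b)
    (hf : ∀ s, a ≤ s → s ≤ b → HasDerivAt f (f' s) s)
    (hf' : ∀ s, a ≤ s → s ≤ b → f' s ≤ 0) : f b ≤ f a := by
  have : AntitoneOn f (Set.Icc a b) := by
    apply antitoneOn_of_hasDerivWithinAt_nonpos (f' := f') (convex_Icc a b)
    · intro s hs
      exact (hf s hs.1 hs.2).continuousAt.continuousWithinAt
    · intro s hs
      have hs := interior_subset hs
      exact (hf s hs.1 hs.2).hasDerivWithinAt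
    · intro s hs
      have hs := interior_subset hs
      exact hf' s hs.1 hs.2
  exact this (Set.left_mem_Icc.2 hab) (Set.right_mem_Icc.2 hab) hab

open scoped InnerProductSpace in
/-- Abstract exponential stability theorem. -/
theorem aux_core {E : Type*} [NormedAddCommGroup E] [InnerProductSpace ℝ E]
    (P V W : ℝ → E) (Q : ℝ → E → ℝ) (kp kd T μ : ℝ)
    (hkd : 1 < kd) (hkp0 : 0 < kp) (hkp : kp < 4 - 4 / kd ^ 2)
    (hP : ∀ t, 0 ≤ t → HasDerivAt P (V t) t)
    (hV : ∀ t, 0 ≤ t → HasDerivAt V (-(kp • W t) - kd • V t) t)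
    (hW : ∀ t, 0 ≤ t → ⟪P t, W t⟫_ℝ = ‖W t‖ ^ 2)
    (hQ : ∀ s x y, 0 ≤ s → Q s x ≤ 2 * Q s y + 2 * ‖x - y‖ ^ 2)
    (hQW : ∀ R : ℝ, ∃ C : ℝ, 0 < C ∧ ∀ s, 0 ≤ s → ‖P s‖ ≤ R → Q s (P s) ≤ C * ‖W s‖ ^ 2)
    (hQc : ∀ s x, 0 ≤ s → ContinuousAt (fun s => Q s x) s)
    (hT : 0 < T) (hμ : 0 < μ)
    (hPE : ∀ t x, 0 ≤ t → μ * T * ‖x‖ ^ 2 ≤ ∫ s in t..(t + T), Q s x) :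
    ∃ k lam : ℝ, 0 < k ∧ 0 < lam ∧ ∀ t, 0 ≤ t →
      ‖P t‖ ^ 2 + ‖V t‖ ^ 2 ≤ k * (‖P 0‖ ^ 2 + ‖V 0‖ ^ 2) * Real.exp (-lam * t) := by
  obtain ⟨ε, hε, hquad⟩ := aux_quad (kd ^ 2 - 1) kp (kd * kp) (by nlinarith) hkp0 (by positivity)
    (by
      have h1 : kp * kd ^ 2 < 4 * kd ^ 2 - 4 := by
        have h := mul_lt_mul_of_pos_right hkp (show 0 < kd ^ 2 by positivity)
        have e : (4 - 4 / kd ^ 2) * kd ^ 2 = 4 * kd ^ 2 - 4 := by field_simp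
        linarith
      nlinarith)
  -- Lyapunov function
  set L : ℝ → ℝ := fun t => kd / 2 * ‖P t‖ ^ 2 + ⟪P t, V t⟫_ℝ + kd / 2 * ‖V t‖ ^ 2 with hL
  have hdP : ∀ t, 0 ≤ t → HasDerivAt (fun t => ‖P t‖ ^ 2) (2 * ⟪P t, V t⟫_ℝ) t :=
    fun t ht => (hP t ht).norm_sq
  have hdV : ∀ t, 0 ≤ t → HasDerivAt (fun t => ‖V t‖ ^ 2)
      (-2 * kp * ⟪V t, W t⟫_ℝ - 2 * kd * ‖V t‖ ^ 2) t := by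
    intro t ht
    convert (hV t ht).norm_sq using 1
    rw [inner_sub_right, inner_neg_right, inner_smul_right, inner_smul_right,
      real_inner_self_eq_norm_sq]
    ring
  set L' : ℝ → ℝ := fun t => -(kd ^ 2 - 1) * ‖V t‖ ^ 2 - kp * ‖W t‖ ^ 2
      - kd * kp * ⟪V t, W t⟫_ℝ with hL'
  have hdL : ∀ t, 0 ≤ t → HasDerivAt L (L' t) t := by
    intro t ht
    have h := (((hdP t ht).const_mul (kd / 2)).add ((hP t ht).inner ℝ (hV t ht))).add
      ((hdV t ht).const_mul (kd / 2))
    refine HasDerivAt.congr_deriv h ?_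
    rw [inner_sub_right, inner_neg_right, inner_smul_right, inner_smul_right,
      real_inner_self_eq_norm_sq, hW t ht, hL']
    ring
  have hL'le : ∀ t, L' t ≤ -ε * (‖V t‖ ^ 2 + ‖W t‖ ^ 2) := by
    intro t
    exact hquad _ _ _ (abs_real_inner_le_norm (V t) (W t))
  have hLanti : ∀ s t, 0 ≤ s → s ≤ t → L t ≤ L s := by
    intro s t hs hst
    apply aux_anti L L' s t hst (fun u hu _ => hdL u (hs.trans hu))
    intro u hu _
    have := hL'le u
    have h2 : 0 ≤ ε * (‖V u‖ ^ 2 + ‖W u‖ ^ 2) := by positivity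
    linarith
  have hLlow : ∀ t, (kd - 1) / 2 * (‖P t‖ ^ 2 + ‖V t‖ ^ 2) ≤ L t := by
    intro t
    have h := (abs_le.1 (abs_real_inner_le_norm (P t) (V t))).1
    simp only [hL]
    nlinarith [sq_nonneg (‖P t‖ - ‖V t‖)]
  have hLup : ∀ t, L t ≤ (kd + 1) / 2 * (‖P t‖ ^ 2 + ‖V t‖ ^ 2) := by
    intro t
    have h := (abs_le.1 (abs_real_inner_le_norm (P t) (V t))).2
    simp only [hL]
    nlinarith [sq_nonneg (‖P t‖ - ‖V t‖)]
  have hL0 : ∀ t, 0 ≤ t → 0 ≤ L t := by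
    intro t _
    refine le_trans ?_ (hLlow t)
    have : 0 < kd - 1 := by linarith
    positivity
  -- boundedness
  obtain ⟨R, hR⟩ : ∃ R : ℝ, ∀ t, 0 ≤ t → ‖P t‖ ≤ R := by
    refine ⟨Real.sqrt (L 0 / ((kd - 1) / 2)), fun t ht => ?_⟩
    apply Real.le_sqrt_of_sq_le
    rw [le_div_iff₀ (by linarith)]
    have h1 := hLlow t
    have h2 := hLanti 0 t le_rfl ht
    nlinarith [sq_nonneg ‖V t‖]
  obtain ⟨C, hC, hCW⟩ := hQW R
  -- displacement bound
  set D : ℝ → ℝ := fun t => L t - L (t + T) with hD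
  have hD0 : ∀ t, 0 ≤ t → 0 ≤ D t := by
    intro t ht
    have := hLanti t (t + T) ht (by linarith)
    simp only [hD]; linarith
  have hdisp : ∀ t s, 0 ≤ t → t ≤ s → s ≤ t + T →
      ‖P t - P s‖ ^ 2 ≤ Real.exp T / ε * D t := by
    intro t s ht hts hsT
    have hd : ∀ u, t ≤ u → u ≤ s → HasDerivAt
        (fun u => Real.exp (-(u - t)) * ‖P u - P t‖ ^ 2 + 1 / ε * L u)
        ((Real.exp (-(u - t)) * -1) * ‖P u - P t‖ ^ 2 +
          Real.exp (-(u - t)) * (2 * ⟪P u - P t, V u⟫_ℝ) + 1 / ε * L' u) u := by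
      intro u hu _
      have h1 : HasDerivAt (fun u => Real.exp (-(u - t))) (Real.exp (-(u - t)) * -1) u :=
        ((hasDerivAt_id u).sub_const t).neg.exp
      have h2 : HasDerivAt (fun u => ‖P u - P t‖ ^ 2) (2 * ⟪P u - P t, V u⟫_ℝ) u :=
        ((hP u (ht.trans hu)).sub_const (P t)).norm_sq
      exact (h1.mul h2).add ((hdL u (ht.trans hu)).const_mul (1 / ε))
    have h := aux_anti _ _ t s hts hd (by
      intro u hu _
      have h1 := hL'le u
      have h2 : 1 / ε * L' u ≤ -(‖V u‖ ^ 2 + ‖W u‖ ^ 2) := by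
        have := mul_le_mul_of_nonneg_left h1 (show 0 ≤ 1 / ε by positivity)
        have e : 1 / ε * (-ε * (‖V u‖ ^ 2 + ‖W u‖ ^ 2)) = -(‖V u‖ ^ 2 + ‖W u‖ ^ 2) := by
          field_simp
        linarith
      have h3 : Real.exp (-(u - t)) ≤ 1 := Real.exp_le_one_iff.2 (by linarith)
      have h3' := Real.exp_pos (-(u - t))
      have h4 := (abs_le.1 (abs_real_inner_le_norm (P u - P t) (V u))).2
      have h5 : 2 * ⟪P u - P t, V u⟫_ℝ - ‖P u - P t‖ ^ 2 ≤ ‖V u‖ ^ 2 := by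
        nlinarith [sq_nonneg (‖P u - P t‖ - ‖V u‖)]
      have h6 := mul_le_mul_of_nonneg_left h5 h3'.le
      have h7 : Real.exp (-(u - t)) * ‖V u‖ ^ 2 ≤ 1 * ‖V u‖ ^ 2 :=
        mul_le_mul_of_nonneg_right h3 (sq_nonneg _)
      nlinarith [sq_nonneg ‖W u‖])
    simp only [sub_self, norm_zero] at h
    have h1 := hLanti s (t + T) (ht.trans hts) hsT
    have h2 : Real.exp (-(s - t)) * ‖P s - P t‖ ^ 2 ≤ 1 / ε * D t := by
      have : 1 / ε * L (t + T) ≤ 1 / ε * L s :=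
        mul_le_mul_of_nonneg_left h1 (by positivity)
      simp only [hD, mul_sub]
      norm_num at h ⊢
      norm_num at this
      linarith
    have h3 : Real.exp (-T) ≤ Real.exp (-(s - t)) := Real.exp_le_exp.2 (by linarith)
    have h4 : Real.exp (-T) * ‖P s - P t‖ ^ 2 ≤ 1 / ε * D t :=
      (mul_le_mul_of_nonneg_right h3 (sq_nonneg _)).trans h2
    have h5 := mul_le_mul_of_nonneg_left h4 (Real.exp_pos T).le
    rw [← mul_assoc, ← Real.exp_add, add_neg_cancel, Real.exp_zero, one_mul] at h5
    rw [norm_sub_rev]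
    calc _ ≤ _ := h5
      _ = _ := by ring
  -- bound on P
  set C1 : ℝ := 2 * C / ε + 2 * (Real.exp T / ε) * T with hC1
  have hPb : ∀ t, 0 ≤ t → μ * T * ‖P t‖ ^ 2 ≤ C1 * D t := by
    intro t ht
    refine (hPE t (P t) ht).trans ?_
    have hcQ : ContinuousOn (fun s => Q s (P t)) (Set.Icc t (t + T)) := fun s hs =>
      (hQc s (P t) (ht.trans hs.1)).continuousWithinAt
    have hdG : ∀ s, t ≤ s → HasDerivAt
        (fun s => 2 * (Real.exp T / ε * D t) * s - 2 * C / ε * L s)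
        (2 * (Real.exp T / ε * D t) * 1 - 2 * C / ε * L' s) s := fun s hs =>
      ((hasDerivAt_id s).const_mul _).sub ((hdL s (ht.trans hs)).const_mul _)
    have h := intervalIntegral.integral_le_sub_of_hasDeriv_right_of_le (a := t) (b := t + T)
      (by linarith)
      (fun s hs => (hdG s hs.1).continuousAt.continuousWithinAt)
      (fun s hs => (hdG s hs.1.le).hasDerivWithinAt)
      (hcQ.integrableOn_Icc) (by
        intro s hs
        have hs0 : 0 ≤ s := ht.trans hs.1.le
        have h1 := hQ s (P t) (P s) hs0
        have h2 := hdisp t s ht hs.1.le hs.2.le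
        have h3 := hCW s hs0 (hR s hs0)
        have h4 := mul_le_mul_of_nonneg_left (hL'le s) (show 0 ≤ 2 * C / ε by positivity)
        have e : 2 * C / ε * (-ε * (‖V s‖ ^ 2 + ‖W s‖ ^ 2)) =
          - (2 * C * (‖V s‖ ^ 2 + ‖W s‖ ^ 2)) := by field_simp
        have h5 : 0 ≤ C * ‖V s‖ ^ 2 := by positivity
        nlinarith)
    refine h.trans (le_of_eq ?_)
    simp only [hC1, hD]
    ring
  -- bound on V
  set C2 : ℝ := (1 + 2 * kd * T + kp * T) / ε with hC2
  have hVb : ∀ t, 0 ≤ t → T * ‖V t‖ ^ 2 ≤ C2 * D t := by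
    intro t ht
    have hd : ∀ u, t ≤ u → u ≤ t + T → HasDerivAt
        (fun u => C2 * L u - (t + T - u) * ‖V u‖ ^ 2)
        (C2 * L' u - ((-1) * ‖V u‖ ^ 2 +
          (t + T - u) * (-2 * kp * ⟪V u, W u⟫_ℝ - 2 * kd * ‖V u‖ ^ 2))) u := by
      intro u hu _
      have h1 : HasDerivAt (fun u => t + T - u) (-1) u := (hasDerivAt_id u).const_sub (t + T)
      exact ((hdL u (ht.trans hu)).const_mul C2).sub (h1.mul (hdV u (ht.trans hu)))
    have h := aux_anti _ _ t (t + T) (by linarith) hd (by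
      intro u hu hu2
      have h4 := mul_le_mul_of_nonneg_left (hL'le u) (show 0 ≤ C2 by positivity)
      have e : C2 * (-ε * (‖V u‖ ^ 2 + ‖W u‖ ^ 2)) =
          - ((1 + 2 * kd * T + kp * T) * (‖V u‖ ^ 2 + ‖W u‖ ^ 2)) := by
        rw [hC2]; field_simp
      have h5 := (abs_le.1 (abs_real_inner_le_norm (V u) (W u))).2
      have h6 : 2 * kp * ⟪V u, W u⟫_ℝ + 2 * kd * ‖V u‖ ^ 2 ≤
          kp * (‖V u‖ ^ 2 + ‖W u‖ ^ 2) + 2 * kd * ‖V u‖ ^ 2 := by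
        nlinarith [mul_nonneg hkp0.le (sq_nonneg (‖V u‖ - ‖W u‖)),
          mul_le_mul_of_nonneg_left h5 hkp0.le]
      have h7 := mul_le_mul_of_nonneg_left h6 (show 0 ≤ t + T - u by linarith)
      have h8 : (t + T - u) * (kp * (‖V u‖ ^ 2 + ‖W u‖ ^ 2) + 2 * kd * ‖V u‖ ^ 2) ≤
          T * (kp * (‖V u‖ ^ 2 + ‖W u‖ ^ 2) + 2 * kd * ‖V u‖ ^ 2) :=
        mul_le_mul_of_nonneg_right (by linarith) (by positivity)
      have h9 : 0 ≤ (1 + 2 * kd * T) * ‖W u‖ ^ 2 := by positivity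
      nlinarith)
    simp only [sub_self, zero_mul, hD] at h ⊢
    have e : t + T - t = T := by ring
    rw [e] at h
    linarith
  have hkd1 : 0 < kd - 1 := by linarith
  set K : ℝ := (kd + 1) / 2 * (C1 / (μ * T) + C2 / T) + 1 + 1 with hK
  obtain ⟨k, lam, hk, hlam, hfin⟩ := aux_iter L T K hT (by
      have : 0 ≤ (kd + 1) / 2 * (C1 / (μ * T) + C2 / T) := by positivity
      linarith) hL0 hLanti (by
      intro t ht
      have h1 : ‖P t‖ ^ 2 ≤ C1 / (μ * T) * D t := by
        rw [div_mul_eq_mul_div, le_div_iff₀ (by positivity)]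
        linarith [hPb t ht]
      have h2 : ‖V t‖ ^ 2 ≤ C2 / T * D t := by
        rw [div_mul_eq_mul_div, le_div_iff₀ (by positivity)]
        linarith [hVb t ht]
      have h3 := hLup t
      have h4 := mul_le_mul_of_nonneg_left (add_le_add h1 h2)
        (show 0 ≤ (kd + 1) / 2 by linarith)
      have h5 := hD0 t ht
      have h6 : L t ≤ K * D t := by
        rw [hK]
        linarith
      exact h6)
  refine ⟨2 / (kd - 1) * k * ((kd + 1) / 2), lam, by positivity, hlam, ?_⟩
  intro t ht
  have h1 := hfin t ht
  have h2 := hLlow t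
  have h3 := hLup 0
  have h4 : k * L 0 * Real.exp (-lam * t) ≤
      k * ((kd + 1) / 2 * (‖P 0‖ ^ 2 + ‖V 0‖ ^ 2)) * Real.exp (-lam * t) := by gcongr
  have h5 := mul_le_mul_of_nonneg_left (h2.trans (h1.trans h4))
    (show 0 ≤ 2 / (kd - 1) by positivity)
  have e : 2 / (kd - 1) * ((kd - 1) / 2 * (‖P t‖ ^ 2 + ‖V t‖ ^ 2)) = ‖P t‖ ^ 2 + ‖V t‖ ^ 2 := by
    field_simp
  rw [e] at h5
  refine h5.trans (le_of_eq ?_)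
  ring

lemma aux_sq {ι : Type*} [Fintype ι] (x : ι → ℝ) : euclNorm x ^ 2 = x ⬝ᵥ x := by
  rw [euclNorm, Real.sq_sqrt (Finset.sum_nonneg fun i _ => mul_self_nonneg _)]
  rfl

lemma aux_norm_sq (x : EuclideanSpace ℝ (Fin 3)) : ‖x‖ ^ 2 = x.ofLp ⬝ᵥ x.ofLp := by
  rw [EuclideanSpace.real_norm_sq_eq]
  simp [dotProduct, sq]

lemma aux_eucl_pos {x : Fin 3 → ℝ} (hx : x ≠ 0) : 0 < euclNorm x := by
  rw [euclNorm]
  apply Real.sqrt_pos.2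
  have h0 : 0 ≤ ∑ i, x i * x i := Finset.sum_nonneg fun i _ => mul_self_nonneg _
  refine lt_of_le_of_ne h0 fun h => hx ?_
  exact dotProduct_self_eq_zero.1 h.symm

lemma aux_projmul (g x : Fin 3 → ℝ) : (proj g) *ᵥ x = x - (g ⬝ᵥ x) • g := by
  rw [proj, Matrix.sub_mulVec, Matrix.one_mulVec, Matrix.vecMulVec_mulVec]
  ext i
  simp [mul_comm]

lemma aux_unit {x : Fin 3 → ℝ} (hx : x ≠ 0) : unitize x ⬝ᵥ unitize x = 1 := by
  have h := aux_eucl_pos hx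
  rw [unitize, smul_dotProduct, dotProduct_smul, ← aux_sq]
  simp only [smul_eq_mul]
  field_simp

lemma aux_quadform (g x : Fin 3 → ℝ) : x ⬝ᵥ (proj g *ᵥ x) = x ⬝ᵥ x - (g ⬝ᵥ x) ^ 2 := by
  rw [aux_projmul, dotProduct_sub, dotProduct_smul, dotProduct_comm x g]
  simp [sq]

lemma aux_projself (g x : Fin 3 → ℝ) (hg : g ⬝ᵥ g = 1) :
    (proj g *ᵥ x) ⬝ᵥ (proj g *ᵥ x) = x ⬝ᵥ x - (g ⬝ᵥ x) ^ 2 := by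
  rw [aux_projmul]
  simp only [dotProduct_sub, dotProduct_smul, sub_dotProduct, smul_dotProduct, hg,
    dotProduct_comm x g, smul_eq_mul]
  ring

lemma aux_quad_nonneg (g x : Fin 3 → ℝ) (hg : g ⬝ᵥ g = 1) :
    0 ≤ x ⬝ᵥ x - (g ⬝ᵥ x) ^ 2 := by
  rw [← aux_projself g x hg]
  exact Finset.sum_nonneg fun i _ => mul_self_nonneg _

lemma aux_Qineq (g x y : Fin 3 → ℝ) (hg : g ⬝ᵥ g = 1) :
    x ⬝ᵥ (proj g *ᵥ x) ≤ 2 * (y ⬝ᵥ (proj g *ᵥ y)) + 2 * ((x - y) ⬝ᵥ (x - y)) := by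
  simp only [aux_quadform]
  have h := aux_quad_nonneg g (y - (x - y)) hg
  simp only [dotProduct_sub, sub_dotProduct, dotProduct_comm y x] at h ⊢
  nlinarith [sq_nonneg (g ⬝ᵥ x - g ⬝ᵥ y)]

lemma aux_cross (r q : Fin 3 → ℝ) (hr : r ≠ 0) (hq : q ≠ 0) :
    (q ⬝ᵥ q) * ((r - q) ⬝ᵥ (proj (unitize q) *ᵥ (r - q))) =
      (r ⬝ᵥ r) * ((proj (unitize r) *ᵥ (r - q)) ⬝ᵥ (proj (unitize r) *ᵥ (r - q))) := by
  have key : ∀ x : Fin 3 → ℝ, x ≠ 0 → ∀ z, (x ⬝ᵥ x) * (z ⬝ᵥ z - (unitize x ⬝ᵥ z) ^ 2)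
      = (x ⬝ᵥ x) * (z ⬝ᵥ z) - (x ⬝ᵥ z) ^ 2 := by
    intro x hx z
    have h := aux_eucl_pos hx
    rw [unitize, smul_dotProduct, ← aux_sq x]
    simp only [smul_eq_mul]
    field_simp
  rw [aux_projself _ _ (aux_unit hr), aux_quadform, key r hr, key q hq]
  simp only [dotProduct_sub, sub_dotProduct, dotProduct_comm q r]
  ring

lemma aux_toLp {f : ℝ → Fin 3 → ℝ} {f' : Fin 3 → ℝ} {t : ℝ} (h : HasDerivAt f f' t) :
    HasDerivAt (fun t => (WithLp.toLp 2 (f t) : EuclideanSpace ℝ (Fin 3)))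
      (WithLp.toLp 2 f') t := by
  exact ((PiLp.continuousLinearEquiv 2 ℝ (fun _ : Fin 3 => ℝ)).symm
    |>.hasFDerivAt).comp_hasDerivAt t h

lemma aux_cont_entry (q : ℝ → Fin 3 → ℝ) (s : ℝ) (hc : ContinuousAt q s) (h0 : q s ≠ 0)
    (i j : Fin 3) : ContinuousAt (fun s => proj (unitize (q s)) i j) s := by
  have h1 : ∀ i, ContinuousAt (fun s => q s i) s := fun i =>
    (continuous_apply i).continuousAt.comp hc
  have hn : ContinuousAt (fun s => euclNorm (q s)) s := by
    unfold euclNorm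
    simp only [Fin.sum_univ_three]
    have h0 := h1 0
    have h1' := h1 1
    have h2 := h1 2
    exact (((h0.mul h0).add (h1'.mul h1')).add (h2.mul h2)).sqrt
  have hne := (aux_eucl_pos h0).ne'
  have hi := hn.inv₀ hne
  simp only [proj, unitize, Matrix.sub_apply, Matrix.vecMulVec_apply, Pi.smul_apply, smul_eq_mul]
  exact continuousAt_const.sub ((hi.mul (h1 i)).mul (hi.mul (h1 j)))

lemma aux_expand (M : Matrix (Fin 3) (Fin 3) ℝ) (x : Fin 3 → ℝ) :
    x ⬝ᵥ (M *ᵥ x) = ∑ i, ∑ j, x i * x j * M i j := by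
  simp only [dotProduct, Matrix.mulVec, Finset.mul_sum]
  refine Finset.sum_congr rfl fun i _ => Finset.sum_congr rfl fun j _ => by ring

lemma aux_PE (M : ℝ → Matrix (Fin 3) (Fin 3) ℝ) (T μ t : ℝ) (hT : 0 < T)
    (hint : ∀ i j, IntervalIntegrable (fun s => M s i j) volume t (t + T))
    (h : ((T⁻¹ • Matrix.of fun i j => ∫ τ in t..(t + T), M τ i j) -
        μ • (1 : Matrix (Fin 3) (Fin 3) ℝ)).PosSemidef) (x : Fin 3 → ℝ) :
    μ * T * (x ⬝ᵥ x) ≤ ∫ s in t..(t + T), x ⬝ᵥ (M s *ᵥ x) := by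
  have h1 := h.dotProduct_mulVec_nonneg x
  simp only [star_trivial, Matrix.sub_mulVec, Matrix.smul_mulVec, Matrix.one_mulVec,
    dotProduct_sub, dotProduct_smul, smul_eq_mul] at h1
  have h2 : ∫ s in t..(t + T), x ⬝ᵥ (M s *ᵥ x) =
      x ⬝ᵥ ((Matrix.of fun i j => ∫ τ in t..(t + T), M τ i j) *ᵥ x) := by
    simp only [aux_expand]
    rw [intervalIntegral.integral_finsetSum]
    · refine Finset.sum_congr rfl fun i _ => ?_
      rw [intervalIntegral.integral_finsetSum]
      · refine Finset.sum_congr rfl fun j _ => ?_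
        rw [intervalIntegral.integral_const_mul]
        rfl
      · intro j _
        exact (hint i j).const_mul _
    · intro i _
      have := IntervalIntegrable.sum (μ := volume) (a := t) (b := t + T) Finset.univ
        (f := fun j s => x i * x j * M s i j) (fun j _ => (hint i j).const_mul _)
      simpa [Finset.sum_fn] using this
  rw [h2]
  have h3 := mul_le_mul_of_nonneg_left h1 hT.le
  rw [mul_sub, ← mul_assoc, mul_inv_cancel₀ hT.ne'] at h3
  linarith

lemma aux_elim (a b : Fin 3 → ℝ) :
    euclNorm (Sum.elim a b : Fin 3 ⊕ Fin 3 → ℝ) =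
      Real.sqrt (‖(WithLp.toLp 2 a : EuclideanSpace ℝ (Fin 3))‖ ^ 2 +
        ‖(WithLp.toLp 2 b : EuclideanSpace ℝ (Fin 3))‖ ^ 2) := by
  rw [aux_norm_sq, aux_norm_sq, euclNorm]
  simp [dotProduct]

/-- exponential stability of the first follower.  Leader (agent 1) and first
follower (agent 2) have double-integrator dynamics; the follower applies
`u₂ = −k_p π_{g₂₁} p*₂₁ + k_d ṽ₂₁ + u*₂` with `k_d > 1` and `0 < k_p < 4 − 4/k_d²`.
If the desired accelerations and relative velocity are bounded, the desired bearing
`g*₂₁(t)` is well defined and persistently exciting, and the actual bearing stays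
well defined, then the error `x̃₂₁ = (p̃₂₁, ṽ₂₁) = 0` is exponentially stable. -/
theorem stmt5
    (p1 p2 v1 v2 ps1 ps2 vs1 vs2 us1 us2 : ℝ → (Fin 3 → ℝ)) (kp kd : ℝ)
    (hkd : 1 < kd) (hkp0 : 0 < kp) (hkp : kp < 4 - 4 / kd ^ 2)
    -- actual dynamics: ṗᵢ = vᵢ, v̇ᵢ = uᵢ, with u₁ = u*₁ and u₂ the bearing control law
    (hp1 : ∀ t : ℝ, 0 ≤ t → HasDerivAt p1 (v1 t) t)
    (hp2 : ∀ t : ℝ, 0 ≤ t → HasDerivAt p2 (v2 t) t)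
    (hv1 : ∀ t : ℝ, 0 ≤ t → HasDerivAt v1 (us1 t) t)
    (hv2 : ∀ t : ℝ, 0 ≤ t → HasDerivAt v2
      (-kp • (proj (unitize (p1 t - p2 t))).mulVec (ps1 t - ps2 t)
        + kd • ((v1 t - v2 t) - (vs1 t - vs2 t)) + us2 t) t)
    -- desired trajectories: ṗ*ᵢ = v*ᵢ, v̇*ᵢ = u*ᵢ
    (hps1 : ∀ t : ℝ, 0 ≤ t → HasDerivAt ps1 (vs1 t) t)
    (hps2 : ∀ t : ℝ, 0 ≤ t → HasDerivAt ps2 (vs2 t) t)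
    (hvs1 : ∀ t : ℝ, 0 ≤ t → HasDerivAt vs1 (us1 t) t)
    (hvs2 : ∀ t : ℝ, 0 ≤ t → HasDerivAt vs2 (us2 t) t)
    -- boundedness of desired accelerations and desired relative velocity and position
    (hbound : ∃ M : ℝ, ∀ t : ℝ, 0 ≤ t →
      euclNorm (us1 t) ≤ M ∧ euclNorm (us2 t) ≤ M ∧
      euclNorm (vs1 t - vs2 t) ≤ M ∧ euclNorm (ps1 t - ps2 t) ≤ M)
    -- the desired bearing is well defined: inf_t ‖p*₂₁(t)‖ > 0
    (hlow : ∃ δ : ℝ, 0 < δ ∧ ∀ t : ℝ, 0 ≤ t → δ ≤ euclNorm (ps1 t - ps2 t))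
    -- the desired bearing g*₂₁ is persistently exciting
    (hPE : ∃ T μ : ℝ, μ < 1 ∧ IsPEWith (fun t => proj (unitize (ps1 t - ps2 t))) T μ)
    -- no collision/occlusion: the actual bearing g₂₁ is well defined for all t ≥ 0
    (hcol : ∀ t : ℝ, 0 ≤ t → p1 t ≠ p2 t) :
    ∃ k lam : ℝ, 0 < k ∧ 0 < lam ∧ ∀ t : ℝ, 0 ≤ t →
      euclNorm (Sum.elim
          (((p1 t - p2 t) - (ps1 t - ps2 t)))
          (((v1 t - v2 t) - (vs1 t - vs2 t))) : Fin 3 ⊕ Fin 3 → ℝ) ≤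
        k * euclNorm (Sum.elim
          (((p1 0 - p2 0) - (ps1 0 - ps2 0)))
          (((v1 0 - v2 0) - (vs1 0 - vs2 0))) : Fin 3 ⊕ Fin 3 → ℝ)
          * Real.exp (-lam * t) := by
  obtain ⟨δ, hδ, hlow⟩ := hlow
  obtain ⟨T, μ, -, hT, hμ, hPE⟩ := hPE
  set q : ℝ → Fin 3 → ℝ := fun t => ps1 t - ps2 t with hq
  set r : ℝ → Fin 3 → ℝ := fun t => p1 t - p2 t with hr
  have hq0 : ∀ t, 0 ≤ t → q t ≠ 0 := by
    intro t ht h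
    have h1 := hlow t ht
    change δ ≤ euclNorm (q t) at h1
    rw [h] at h1
    simp [euclNorm] at h1
    linarith
  have hr0 : ∀ t, 0 ≤ t → r t ≠ 0 := fun t ht => sub_ne_zero.2 (hcol t ht)
  have hqc : ∀ t, 0 ≤ t → ContinuousAt q t := fun t ht =>
    ((hps1 t ht).sub (hps2 t ht)).continuousAt
  have hent : ∀ t, 0 ≤ t → ∀ i j, ContinuousAt (fun s => proj (unitize (q s)) i j) t :=
    fun t ht i j => aux_cont_entry q t (hqc t ht) (hq0 t ht) i j
  obtain ⟨k, lam, hk, hlam, hmain⟩ := aux_core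
    (E := EuclideanSpace ℝ (Fin 3))
    (fun t => WithLp.toLp 2 (r t - q t))
    (fun t => WithLp.toLp 2 ((v1 t - v2 t) - (vs1 t - vs2 t)))
    (fun t => WithLp.toLp 2 (proj (unitize (r t)) *ᵥ (r t - q t)))
    (fun s x => x.ofLp ⬝ᵥ (proj (unitize (q s)) *ᵥ x.ofLp))
    kp kd T μ hkd hkp0 hkp
    (fun t ht => aux_toLp (((hp1 t ht).sub (hp2 t ht)).sub ((hps1 t ht).sub (hps2 t ht))))
    (by
      intro t ht
      have h := aux_toLp (((hv1 t ht).sub (hv2 t ht)).sub ((hvs1 t ht).sub (hvs2 t ht)))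
      refine HasDerivAt.congr_deriv h ?_
      symm
      rw [← WithLp.toLp_smul, ← WithLp.toLp_smul, ← WithLp.toLp_neg, ← WithLp.toLp_sub]
      congr 1
      have e : proj (unitize (r t)) *ᵥ r t = 0 := by
        have hn := aux_eucl_pos (hr0 t ht)
        rw [aux_projmul, unitize, smul_dotProduct, ← aux_sq, smul_smul]
        have : ((euclNorm (r t))⁻¹ • euclNorm (r t) ^ 2) * (euclNorm (r t))⁻¹ = 1 := by
          simp only [smul_eq_mul]; field_simp
        rw [this, one_smul, sub_self]
      rw [Matrix.mulVec_sub, e]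
      change _ = us1 t - (-kp • (proj (unitize (r t))).mulVec (q t)
        + kd • ((v1 t - v2 t) - (vs1 t - vs2 t)) + us2 t) - (us1 t - us2 t)
      module)
    (by
      intro t ht
      rw [aux_norm_sq, EuclideanSpace.inner_eq_star_dotProduct]
      simp only [star_trivial]
      rw [aux_projself _ _ (aux_unit (hr0 t ht)), dotProduct_comm, aux_quadform])
    (by
      intro s x y hs
      rw [aux_norm_sq]
      exact aux_Qineq _ _ _ (aux_unit (hq0 s hs)))
    (by
      intro R
      refine ⟨2 + 2 * R ^ 2 / δ ^ 2, by positivity, ?_⟩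
      intro s hs hR
      rw [aux_norm_sq]
      simp only
      have hc := aux_cross (r s) (q s) (hr0 s hs) (hq0 s hs)
      have hm : δ ^ 2 ≤ q s ⬝ᵥ q s := by
        rw [← aux_sq]
        exact pow_le_pow_left₀ hδ.le (hlow s hs) 2
      have hPR : (r s - q s) ⬝ᵥ (r s - q s) ≤ R ^ 2 := by
        have := pow_le_pow_left₀ (norm_nonneg _) hR 2
        rwa [aux_norm_sq] at this
      have hW0 : 0 ≤ (proj (unitize (r s)) *ᵥ (r s - q s)) ⬝ᵥ
          (proj (unitize (r s)) *ᵥ (r s - q s)) :=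
        Finset.sum_nonneg fun i _ => mul_self_nonneg _
      have hrr : r s ⬝ᵥ r s ≤ 2 * (q s ⬝ᵥ q s) + 2 * ((r s - q s) ⬝ᵥ (r s - q s)) := by
        have : 0 ≤ (q s - (r s - q s)) ⬝ᵥ (q s - (r s - q s)) :=
          Finset.sum_nonneg fun i _ => mul_self_nonneg _
        simp only [dotProduct_sub, sub_dotProduct, dotProduct_comm (q s) (r s)] at this ⊢
        linarith
      have hδ2 : 0 < δ ^ 2 := by positivity
      have h1 : r s ⬝ᵥ r s ≤ (q s ⬝ᵥ q s) * (2 + 2 * R ^ 2 / δ ^ 2) := by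
        have h2 : δ ^ 2 * (2 * R ^ 2 / δ ^ 2) ≤ (q s ⬝ᵥ q s) * (2 * R ^ 2 / δ ^ 2) :=
          mul_le_mul_of_nonneg_right hm (by positivity)
        have h3 : δ ^ 2 * (2 * R ^ 2 / δ ^ 2) = 2 * R ^ 2 := by field_simp
        linarith
      have h4 := mul_le_mul_of_nonneg_right h1 hW0
      rw [← hc, mul_assoc] at h4
      exact le_of_mul_le_mul_left h4 (hδ2.trans_le hm))
    (by
      intro s x hs
      simp only [aux_expand]
      exact tendsto_finsetSum _ fun i _ => tendsto_finsetSum _ fun j _ =>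
        (hent s hs i j).const_mul _)
    hT hμ
    (by
      intro t x ht
      rw [aux_norm_sq]
      refine aux_PE (fun s => proj (unitize (q s))) T μ t hT ?_ (hPE t ht) x.ofLp
      intro i j
      apply ContinuousOn.intervalIntegrable
      rw [Set.uIcc_of_le (by linarith)]
      exact fun s hs => (hent s (ht.trans hs.1) i j).continuousWithinAt)
  refine ⟨Real.sqrt k, lam / 2, Real.sqrt_pos.2 hk, by positivity, ?_⟩
  intro t ht
  rw [aux_elim, aux_elim]
  have h := Real.sqrt_le_sqrt (hmain t ht)
  refine h.trans (le_of_eq ?_)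
  have e : Real.exp (-lam * t) = Real.exp (-(lam / 2) * t) ^ 2 := by
    rw [← Real.exp_nat_mul]; congr 1; push_cast; ring
  rw [e, Real.sqrt_mul (by positivity), Real.sqrt_mul hk.le, Real.sqrt_sq (Real.exp_pos _).le]
end
end
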